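/- Let p = p(n) satisfy p·n → 0 as n → ∞, and let G ∈ G(n,p). Then β(G) = n(1+o(1)) asymptotically almost surely; that is, for every ε > 0, the probability that |β(G)/n − 1| ≤ ε tends to 1 as n → ∞. -/

import Mathlib

open scoped Classical BigOperators
open Filter Topology

noncomputable section

namespace MetricDimPaper

/-- `R` is a resolving set of `G`: every pair of distinct vertices is distinguished by its
vector of (extended, possibly infinite) distances to the vertices of `R`. -/
def Resolves {V : Type*} (G : SimpleGraph V) (R : Set V) : Prop :=
  ∀ u v : V, u ≠ v → ∃ w ∈ R, G.edist u w ≠ G.edist v w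

/-- The metric dimension of a graph: the least cardinality of a resolving set, with the
convention that a single isolated vertex has metric dimension 1. -/
def metricDim {V : Type*} (G : SimpleGraph V) : ℕ :=
  if Nat.card V = 1 then 1
  else sInf {m : ℕ | ∃ R : Set V, R.ncard = m ∧ Resolves G R}

/-- A tree: a connected acyclic graph. -/
def IsTree {V : Type*} (G : SimpleGraph V) : Prop := G.Connected ∧ G.IsAcyclic

/-- degree of a vertex (as `Nat.card` of the neighbor set). -/
def ndeg {V : Type*} (G : SimpleGraph V) (v : V) : ℕ := (G.neighborSet v).ncard

/-- metric dimension as a real number -/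
def betaR {n : ℕ} (G : SimpleGraph (Fin n)) : ℝ := (metricDim G : ℝ)

def treeSet (n : ℕ) : Set (SimpleGraph (Fin n)) := {G | IsTree G}

def forestSet (n : ℕ) : Set (SimpleGraph (Fin n)) := {G | G.IsAcyclic}

/-- Expectation of `f` under the uniform distribution on the (finite) set `S` of graphs. -/
def unifExp {n : ℕ} (S : Set (SimpleGraph (Fin n))) (f : SimpleGraph (Fin n) → ℝ) : ℝ :=
  (∑ᶠ G ∈ S, f G) / (Nat.card ↥S)

/-- Variance of `f` under the uniform distribution on `S`. -/
def unifVar {n : ℕ} (S : Set (SimpleGraph (Fin n))) (f : SimpleGraph (Fin n) → ℝ) : ℝ :=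
  unifExp S (fun G => (f G - unifExp S f) ^ 2)

/-- Probability of the event `A` under the uniform distribution on `S`. -/
def unifPr {n : ℕ} (S A : Set (SimpleGraph (Fin n))) : ℝ :=
  (Nat.card ↥(S ∩ A) : ℝ) / (Nat.card ↥S)

/-- The probability weight of an individual graph in the Erdős–Rényi model `G(n,p)`. -/
def erWeight (n : ℕ) (p : ℝ) (G : SimpleGraph (Fin n)) : ℝ :=
  p ^ (Nat.card ↥G.edgeSet) * (1 - p) ^ (n.choose 2 - Nat.card ↥G.edgeSet)

/-- Expectation of `f` in the Erdős–Rényi model `G(n,p)`. -/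
def erExp (n : ℕ) (p : ℝ) (f : SimpleGraph (Fin n) → ℝ) : ℝ :=
  ∑ᶠ G : SimpleGraph (Fin n), erWeight n p G * f G

/-- Variance of `f` in the Erdős–Rényi model `G(n,p)`. -/
def erVar (n : ℕ) (p : ℝ) (f : SimpleGraph (Fin n) → ℝ) : ℝ :=
  erExp n p (fun G => (f G - erExp n p f) ^ 2)

/-- Probability of the event `A` in the Erdős–Rényi model `G(n,p)`. -/
def erPr (n : ℕ) (p : ℝ) (A : Set (SimpleGraph (Fin n))) : ℝ :=
  ∑ᶠ G ∈ A, erWeight n p G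

/-- The cumulative distribution function of the standard normal law. -/
def stdGaussianCDF (x : ℝ) : ℝ :=
  (Real.sqrt (2 * Real.pi))⁻¹ * ∫ t in Set.Iic x, Real.exp (-(t ^ 2) / 2)

/-- The normalized metric dimension `(β - E β)/sqrt (Var β)` for the uniform model on `S`. -/
def normβ {n : ℕ} (S : Set (SimpleGraph (Fin n))) (G : SimpleGraph (Fin n)) : ℝ :=
  (betaR G - unifExp S betaR) / Real.sqrt (unifVar S betaR)

/-- The normalized metric dimension `(β - E β)/sqrt (Var β)` for the `G(n,p)` model. -/
def erNormβ (n : ℕ) (p : ℝ) (G : SimpleGraph (Fin n)) : ℝ :=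
  (betaR G - erExp n p betaR) / Real.sqrt (erVar n p betaR)


theorem metricDim_le_card {V : Type*} [Fintype V] (G : SimpleGraph V) (h : Fintype.card V ≠ 1) :
    metricDim G ≤ Fintype.card V := by
  rw [metricDim, if_neg (by rwa [Nat.card_eq_fintype_card])]
  refine Nat.sInf_le ⟨Set.univ, by rw [Set.ncard_univ, Nat.card_eq_fintype_card], fun u v huv => ?_⟩
  exact ⟨v, Set.mem_univ v, by simpa [SimpleGraph.edist_self] using huv⟩

theorem edist_eq_top_of_isIsolated {V : Type*} {G : SimpleGraph V} {u w : V}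
    (hu : G.IsIsolated u) (huw : u ≠ w) : G.edist u w = ⊤ := by
  refine SimpleGraph.edist_eq_top_of_not_reachable ?_
  rintro ⟨walk⟩
  cases walk with
  | nil => exact huw rfl
  | cons hadj _ => exact hu _ hadj

/-- A resolving set misses at most one isolated vertex. -/
theorem Resolves.card_le {V : Type*} [Fintype V] {G : SimpleGraph V} {R : Set V}
    (hR : Resolves G R) : Fintype.card V ≤ R.ncard + 2 * G.edgeFinset.card + 1 := by
  have hcover : (Finset.univ : Finset V) ⊆
      R.toFinset ∪ Finset.univ.filter (fun v => 0 < G.degree v) ∪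
        Finset.univ.filter (fun v => v ∉ R ∧ G.IsIsolated v) := by
    intro v _
    by_cases hv : G.IsIsolated v
    · by_cases hvR : v ∈ R <;> simp [hv, hvR]
    · have : 0 < G.degree v :=
        (G.degree_pos_iff_exists_adj v).2 (SimpleGraph.exists_adj_iff_not_isIsolated.2 hv)
      simp [this]
  have hisol : (Finset.univ.filter (fun v => v ∉ R ∧ G.IsIsolated v)).card ≤ 1 := by
    refine Finset.card_le_one.2 fun u hu v hv => ?_
    simp only [Finset.mem_filter, Finset.mem_univ, true_and] at hu hv
    by_contra huv
    obtain ⟨w, hw, hne⟩ := hR u v huv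
    refine hne ?_
    rw [edist_eq_top_of_isIsolated hu.2 (fun h => hu.1 (h ▸ hw)),
      edist_eq_top_of_isIsolated hv.2 (fun h => hv.1 (h ▸ hw))]
  have hdeg : (Finset.univ.filter (fun v => 0 < G.degree v)).card ≤ 2 * G.edgeFinset.card := by
    rw [← G.sum_degrees_eq_twice_card_edges, Finset.card_filter]
    exact Finset.sum_le_sum fun v _ => by split_ifs <;> omega
  have hcard := Finset.card_le_card hcover
  have h₁ := Finset.card_union_le
    (R.toFinset ∪ Finset.univ.filter (fun v => 0 < G.degree v))
    (Finset.univ.filter (fun v => v ∉ R ∧ G.IsIsolated v))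
  have h₂ := Finset.card_union_le R.toFinset (Finset.univ.filter (fun v => 0 < G.degree v))
  rw [Finset.card_univ] at hcard
  rw [Set.ncard_eq_toFinset_card']
  omega

theorem card_le_metricDim {V : Type*} [Fintype V] (G : SimpleGraph V)
    (h : Fintype.card V ≠ 1) :
    Fintype.card V ≤ metricDim G + 2 * G.edgeFinset.card + 1 := by
  rw [metricDim, if_neg (by rwa [Nat.card_eq_fintype_card])]
  have hne : {m : ℕ | ∃ R : Set V, R.ncard = m ∧ Resolves G R}.Nonempty :=
    ⟨_, Set.univ, rfl, fun u v huv =>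
      ⟨v, Set.mem_univ v, by simpa [SimpleGraph.edist_self] using huv⟩⟩
  obtain ⟨R, hcard, hR⟩ := Nat.sInf_mem hne
  rw [← hcard]
  exact hR.card_le

theorem sum_simpleGraph_apply_card (n : ℕ) (f : ℕ → ℝ) :
    ∑ G : SimpleGraph (Fin n), f (Nat.card G.edgeSet) =
      ∑ m ∈ Finset.range (n.choose 2 + 1), (n.choose 2).choose m • f m := by
  have htop : (⊤ : SimpleGraph (Fin n)).edgeFinset.card = n.choose 2 := by
    rw [SimpleGraph.card_edgeFinset_top_eq_card_choose_two, Fintype.card_fin]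
  rw [← htop, ← Finset.sum_powerset_apply_card]
  refine Finset.sum_bij' (fun G _ => G.edgeFinset)
    (fun t _ => SimpleGraph.fromEdgeSet (t : Set (Sym2 (Fin n)))) ?_ ?_ ?_ ?_ ?_
  · intro G _
    rw [Finset.mem_powerset]
    exact SimpleGraph.edgeFinset_mono le_top
  · intro t _
    exact Finset.mem_univ _
  · intro G _
    simp
  · intro t ht
    rw [Finset.mem_powerset] at ht
    refine Finset.coe_injective ?_
    rw [SimpleGraph.coe_edgeFinset, SimpleGraph.edgeSet_fromEdgeSet, sdiff_eq_left,
      Set.disjoint_left]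
    intro e he
    have := ht he
    simpa using this
  · intro G _
    rw [Nat.card_eq_fintype_card, SimpleGraph.edgeFinset_card]

theorem sum_erWeight (n : ℕ) (p : ℝ) : ∑ G : SimpleGraph (Fin n), erWeight n p G = 1 := by
  have h := congrArg (Polynomial.eval p) (bernsteinPolynomial.sum ℝ (n.choose 2))
  simp only [Polynomial.eval_finsetSum, bernsteinPolynomial, Polynomial.eval_mul,
    Polynomial.eval_natCast, Polynomial.eval_pow, Polynomial.eval_X, Polynomial.eval_sub,
    Polynomial.eval_one] at h
  rw [← h]
  refine (sum_simpleGraph_apply_card n fun m => p ^ m * (1 - p) ^ (n.choose 2 - m)).trans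
    (Finset.sum_congr rfl fun m _ => ?_)
  rw [nsmul_eq_mul, mul_assoc]

theorem sum_erWeight_mul_card (n : ℕ) (p : ℝ) :
    ∑ G : SimpleGraph (Fin n), erWeight n p G * Nat.card G.edgeSet = n.choose 2 * p := by
  have h := congrArg (Polynomial.eval p) (bernsteinPolynomial.sum_smul ℝ (n.choose 2))
  simp only [Polynomial.eval_finsetSum, bernsteinPolynomial, Polynomial.eval_mul,
    Polynomial.eval_natCast, Polynomial.eval_pow, Polynomial.eval_X, Polynomial.eval_sub,
    Polynomial.eval_one, nsmul_eq_mul] at h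
  rw [← h]
  refine (sum_simpleGraph_apply_card n
    fun m => p ^ m * (1 - p) ^ (n.choose 2 - m) * m).trans (Finset.sum_congr rfl fun m _ => ?_)
  rw [nsmul_eq_mul]
  ring

theorem erWeight_nonneg (n : ℕ) {p : ℝ} (hp : 0 ≤ p ∧ p ≤ 1) (G : SimpleGraph (Fin n)) :
    0 ≤ erWeight n p G :=
  mul_nonneg (pow_nonneg hp.1 _) (pow_nonneg (sub_nonneg.2 hp.2) _)

theorem erPr_eq_sum (n : ℕ) (p : ℝ) (A : Set (SimpleGraph (Fin n))) :
    erPr n p A = ∑ G : SimpleGraph (Fin n), if G ∈ A then erWeight n p G else 0 := by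
  rw [erPr, finsum_mem_def, finsum_eq_sum_of_fintype]
  simp only [Set.indicator_apply]

theorem erPr_le_one (n : ℕ) {p : ℝ} (hp : 0 ≤ p ∧ p ≤ 1) (A : Set (SimpleGraph (Fin n))) :
    erPr n p A ≤ 1 := by
  rw [erPr_eq_sum, ← sum_erWeight n p]
  refine Finset.sum_le_sum fun G _ => ?_
  split_ifs
  · exact le_rfl
  · exact erWeight_nonneg n hp G

/-- Markov's inequality for the number of edges, in terms of the metric dimension. -/
theorem le_erPr_betaR {n : ℕ} (hn : 2 ≤ n) {p ε : ℝ} (hp : 0 ≤ p ∧ p ≤ 1) (hε : 0 < ε) :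
    1 - (p * n / ε + 1 / (ε * n)) ≤ erPr n p {G | |betaR G / n - 1| ≤ ε} := by
  have hn0 : (0 : ℝ) < n := by positivity
  have hcard : Fintype.card (Fin n) ≠ 1 := by rw [Fintype.card_fin]; omega
  have hsum : ∑ G : SimpleGraph (Fin n),
      erWeight n p G * (1 - (2 * Nat.card G.edgeSet + 1) / (ε * n)) =
        1 - (2 * (n.choose 2 * p) + 1) / (ε * n) := by
    have hterm (G : SimpleGraph (Fin n)) :
        erWeight n p G * (1 - (2 * Nat.card G.edgeSet + 1) / (ε * n)) =
          erWeight n p G * (1 - 1 / (ε * n)) -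
            erWeight n p G * Nat.card G.edgeSet * (2 / (ε * n)) := by ring
    simp only [hterm]
    rw [Finset.sum_sub_distrib, ← Finset.sum_mul, ← Finset.sum_mul, sum_erWeight,
      sum_erWeight_mul_card]
    ring
  have hmean : 1 - (p * n / ε + 1 / (ε * n)) ≤ 1 - (2 * (n.choose 2 * p) + 1) / (ε * n) := by
    have heq : p * n / ε + 1 / (ε * n) = (p * n * n + 1) / (ε * n) := by field_simp
    rw [heq, Nat.cast_choose_two]
    have hnum : 2 * ((n : ℝ) * (n - 1) / 2 * p) + 1 ≤ p * n * n + 1 := by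
      nlinarith [mul_nonneg hp.1 hn0.le]
    exact sub_le_sub_left (div_le_div_of_nonneg_right hnum (by positivity)) 1
  refine hmean.trans (hsum ▸ ?_)
  rw [erPr_eq_sum]
  refine Finset.sum_le_sum fun G _ => ?_
  have hw := erWeight_nonneg n hp G
  split_ifs with hG
  · refine mul_le_of_le_one_right hw ?_
    have : 0 ≤ (2 * (Nat.card G.edgeSet : ℝ) + 1) / (ε * n) := by positivity
    linarith
  · refine mul_nonpos_of_nonneg_of_nonpos hw ?_
    rw [sub_nonpos, one_le_div (by positivity)]
    have hupper : betaR G ≤ n := by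
      have := metricDim_le_card G hcard
      rw [Fintype.card_fin] at this
      unfold betaR
      exact_mod_cast this
    have hlower : (n : ℝ) ≤ betaR G + 2 * Nat.card G.edgeSet + 1 := by
      have := card_le_metricDim G hcard
      rw [Fintype.card_fin, SimpleGraph.edgeFinset_card, ← Nat.card_eq_fintype_card] at this
      unfold betaR
      exact_mod_cast this
    rw [Set.mem_ofPred_eq, not_le, abs_of_nonpos (sub_nonpos.2 ((div_le_one hn0).2 hupper)),
      neg_sub, lt_sub_iff_add_lt', ← lt_sub_iff_add_lt, div_lt_iff₀ hn0] at hG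
    linarith

/-- if `p·n → 0` then a.a.s. `β(G(n,p)) = n(1+o(1))`: for every `ε > 0` the
probability that `|β(G)/n − 1| ≤ ε` tends to `1`. -/
theorem er_metricDim_subcritical (p : ℕ → ℝ) (hp01 : ∀ n : ℕ, 0 ≤ p n ∧ p n ≤ 1)
    (hp : Tendsto (fun n : ℕ => p n * n) atTop (𝓝 0)) :
    ∀ ε : ℝ, 0 < ε →
      Tendsto (fun n : ℕ => erPr n (p n) {G | |betaR G / n - 1| ≤ ε}) atTop (𝓝 1) := by
  intro ε hε
  have hlim : Tendsto (fun n : ℕ => 1 - (p n * n / ε + 1 / (ε * n))) atTop (𝓝 1) := by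
    have hinv : Tendsto (fun n : ℕ => 1 / (ε * n)) atTop (𝓝 0) :=
      (tendsto_natCast_atTop_atTop.const_mul_atTop hε).const_div_atTop 1
    simpa using ((hp.div_const ε).add hinv).const_sub 1
  refine tendsto_of_tendsto_of_tendsto_of_le_of_le' hlim tendsto_const_nhds ?_ ?_
  · filter_upwards [eventually_ge_atTop 2] with n hn
    exact le_erPr_betaR hn (hp01 n) hε
  · exact Eventually.of_forall fun n => erPr_le_one n (hp01 n) _

end MetricDimPaper
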